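/- arXiv:1108.3118 — 2 statements merged into one kernel-verified Lean document; each statement's English description precedes it below -/
import Mathlib

section
/- Let N ≥ 1 and α, β ∈ ℝ with N + α − 2 > 0 and N + α − 2 < 4(β − α + 2). Let ω₁(x) = (1 + |x|²)^{α/2} and ω₂(x) = g(x)(1 + |x|²)^{β/2}, where g : ℝ^N → ℝ is a smooth positive function with lim_{|x|→∞} g(x) = c for some constant c ∈ (0, ∞). Then there is no stable sub-solution of the equation −div(ω₁ ∇u) = ω₂ e^u in ℝ^N. -/
open MeasureTheory Filter Real
open scoped RealInnerProductSpace

noncomputable def vdiv {N : ℕ} (V : EuclideanSpace ℝ (Fin N) → EuclideanSpace ℝ (Fin N))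
    (x : EuclideanSpace ℝ (Fin N)) : ℝ :=
  LinearMap.trace ℝ (EuclideanSpace ℝ (Fin N)) (fderiv ℝ V x).toLinearMap

def annulus (N : ℕ) (R : ℝ) : Set (EuclideanSpace ℝ (Fin N)) :=
  {x | R < ‖x‖ ∧ ‖x‖ < 2 * R}


theorem HasCompactSupport.integral_mul_vdiv {N : ℕ}
    {V : EuclideanSpace ℝ (Fin N) → EuclideanSpace ℝ (Fin N)}
    {η : EuclideanSpace ℝ (Fin N) → ℝ} (hηc : HasCompactSupport η) (hη : ContDiff ℝ 1 η)
    (hV : ContDiff ℝ 1 V) :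
    ∫ x, η x * vdiv V x = -∫ x, ⟪V x, gradient η x⟫ := by
  let b := EuclideanSpace.basisFun (Fin N) ℝ
  have hη' : Continuous (fderiv ℝ η) := hη.continuous_fderiv one_ne_zero
  have hV' : Continuous (fderiv ℝ V) := hV.continuous_fderiv one_ne_zero
  have hVi : ∀ i, ContDiff ℝ 1 (fun x => ⟪b i, V x⟫) := fun i => contDiff_const.inner ℝ hV
  have hVd : ∀ i x, fderiv ℝ (fun x => ⟪b i, V x⟫) x (b i) = ⟪b i, fderiv ℝ V x (b i)⟫ := by
    intro i x
    rw [fderiv_inner_apply ℝ (differentiableAt_const _) (hV.differentiable one_ne_zero x)]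
    simp
  have hint₁ : ∀ i, Integrable (fun x => η x * ⟪b i, fderiv ℝ V x (b i)⟫) := fun i =>
    Continuous.integrable_of_hasCompactSupport
      (hη.continuous.mul (continuous_const.inner (hV'.clm_apply continuous_const)))
      hηc.mul_right
  have hint₂ : ∀ i, Integrable (fun x => fderiv ℝ η x (b i) * ⟪b i, V x⟫) := fun i =>
    Continuous.integrable_of_hasCompactSupport
      ((hη'.clm_apply continuous_const).mul (hVi i).continuous)
      ((hηc.fderiv_apply ℝ (b i)).mul_right)
  have hparts : ∀ i, ∫ x, η x * ⟪b i, fderiv ℝ V x (b i)⟫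
      = -∫ x, fderiv ℝ η x (b i) * ⟪b i, V x⟫ := by
    intro i
    simp_rw [← hVd i]
    refine integral_mul_fderiv_eq_neg_fderiv_mul_of_integrable (hint₂ i) ?_ ?_
      (fun x _ => hη.differentiable one_ne_zero x)
      (fun x _ => (hVi i).differentiable one_ne_zero x)
    · simpa only [hVd i] using hint₁ i
    · exact Continuous.integrable_of_hasCompactSupport
        (hη.continuous.mul (hVi i).continuous) hηc.mul_right
  have hdiv : ∀ x, η x * vdiv V x = ∑ i, η x * ⟪b i, fderiv ℝ V x (b i)⟫ := by
    intro x
    rw [vdiv, LinearMap.trace_eq_sum_inner _ b, Finset.mul_sum]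
    rfl
  have hgrad : ∀ x, ⟪V x, gradient η x⟫ = ∑ i, fderiv ℝ η x (b i) * ⟪b i, V x⟫ := by
    intro x
    rw [← b.sum_inner_mul_inner]
    refine Finset.sum_congr rfl fun i _ => ?_
    rw [← inner_gradient_left, real_inner_comm, real_inner_comm (gradient η x), mul_comm]
  simp_rw [hdiv, hgrad]
  rw [integral_finsetSum _ fun i _ => hint₁ i, integral_finsetSum _ fun i _ => hint₂ i,
    ← Finset.sum_neg_distrib]
  exact Finset.sum_congr rfl fun i _ => hparts i

theorem norm_add_smul_sq_le {E : Type*} [NormedAddCommGroup E] [InnerProductSpace ℝ E]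
    (P Q : E) {t : ℝ} (ht : 0 < t) (ht2 : t < 2) :
    ‖Q + t • P‖ ^ 2 ≤ (t + 2) / 4 * (2 * ⟪P, Q + t • P⟫)
      + (1 + (2 - 3 * t) ^ 2 / (8 * t * (2 - t))) * ‖Q‖ ^ 2 := by
  have hδ : 0 < t * (2 - t) := mul_pos ht (by linarith)
  have hne : 2 - t ≠ 0 := by linarith
  have hsq : 0 ≤ t * (2 - t) / 2 * ‖P + ((2 - 3 * t) / (2 * t * (2 - t))) • Q‖ ^ 2 := by
    positivity
  have key : (t + 2) / 4 * (2 * ⟪P, Q + t • P⟫)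
      + (1 + (2 - 3 * t) ^ 2 / (8 * t * (2 - t))) * ‖Q‖ ^ 2 - ‖Q + t • P‖ ^ 2
      = t * (2 - t) / 2 * ‖P + ((2 - 3 * t) / (2 * t * (2 - t))) • Q‖ ^ 2 := by
    simp only [← real_inner_self_eq_norm_sq, inner_add_left, inner_add_right,
      real_inner_smul_left, real_inner_smul_right, real_inner_comm P Q]
    field_simp
    ring
  linarith

section Gradient

variable {E : Type*} [NormedAddCommGroup E] [InnerProductSpace ℝ E] [CompleteSpace E]

theorem ContDiff.gradient {f : E → ℝ} {n m : WithTop ℕ∞} (hf : ContDiff ℝ n f) (h : m + 1 ≤ n) :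
    ContDiff ℝ m (gradient f) :=
  (InnerProductSpace.toDual ℝ E).symm.contDiff.comp (hf.fderiv_right h)

theorem HasGradientAt.exp_mul {f φ : E → ℝ} {f' φ' x : E} (t : ℝ) (hf : HasGradientAt f f' x)
    (hφ : HasGradientAt φ φ' x) :
    HasGradientAt (fun y => Real.exp (t * f y) * φ y)
      (Real.exp (t * f x) • (φ' + (t * φ x) • f')) x := by
  rw [hasGradientAt_iff_hasFDerivAt] at *
  convert! ((hf.const_mul t).exp).mul hφ using 1
  ext y
  simp
  ring

theorem HasGradientAt.pow {f : E → ℝ} {f' x : E} (n : ℕ) (hf : HasGradientAt f f' x) :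
    HasGradientAt (fun y => f y ^ n) ((n * f x ^ (n - 1)) • f') x := by
  rw [hasGradientAt_iff_hasFDerivAt] at *
  convert! hf.pow n using 1
  ext y
  simp

end Gradient

theorem mul_exp_mul_pow_le {A B v χ t : ℝ} (hA : 0 ≤ A) (hB : 0 < B) (hχ₀ : 0 ≤ χ) (hχ₁ : χ ≤ 1)
    (ht : 0 < t) (ht2 : t < 2) :
    A * (Real.exp (2 * t * v) * χ ^ 8)
      ≤ B * (Real.exp ((2 * t + 1) * v) * χ ^ 10) + A * (A / B) ^ (2 * t) := by
  have hexp : Real.exp ((2 * t + 1) * v) = Real.exp (2 * t * v) * Real.exp v := by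
    rw [← Real.exp_add]; ring_nf
  rcases le_total A (B * (Real.exp v * χ ^ 2)) with h | h
  · have h' := mul_le_mul_of_nonneg_right h
      (mul_nonneg (Real.exp_nonneg (2 * t * v)) (pow_nonneg hχ₀ 8))
    have : 0 ≤ A * (A / B) ^ (2 * t) := by positivity
    rw [hexp]
    linarith
  · have h₁ : Real.exp v * χ ^ 2 ≤ A / B := by
      rw [le_div_iff₀ hB]; linarith
    have h₂ : Real.exp (2 * t * v) * χ ^ 8 ≤ (A / B) ^ (2 * t) := by
      calc Real.exp (2 * t * v) * χ ^ 8
          = Real.exp (2 * t * v) * (χ ^ 2) ^ (4 : ℝ) := by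
            rw [show (4 : ℝ) = ((4 : ℕ) : ℝ) by norm_num, Real.rpow_natCast]; ring
        _ ≤ Real.exp (2 * t * v) * (χ ^ 2) ^ (2 * t) := by
            refine mul_le_mul_of_nonneg_left ?_ (Real.exp_nonneg _)
            exact Real.rpow_le_rpow_of_exponent_ge_of_imp (by positivity)
              (pow_le_one₀ hχ₀ hχ₁) (by linarith) (fun _ h => by linarith)
        _ = (Real.exp v * χ ^ 2) ^ (2 * t) := by
            rw [Real.mul_rpow (Real.exp_nonneg v) (by positivity), ← Real.exp_mul, mul_comm v]
        _ ≤ (A / B) ^ (2 * t) := by gcongr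
    have : 0 ≤ B * (Real.exp ((2 * t + 1) * v) * χ ^ 10) := by positivity
    have := mul_le_mul_of_nonneg_left h₂ hA
    linarith

theorem energy_estimate {N : ℕ} {w₁ w₂ u φ : EuclideanSpace ℝ (Fin N) → ℝ}
    (hw₁ : ContDiff ℝ 1 w₁) (hw₁pos : ∀ x, 0 ≤ w₁ x) (hw₂ : Continuous w₂) (hu : ContDiff ℝ 2 u)
    (hsub : ∀ x, -vdiv (fun y => w₁ y • gradient u y) x ≤ w₂ x * Real.exp (u x))
    (hstab : ∀ ψ : EuclideanSpace ℝ (Fin N) → ℝ, ContDiff ℝ 2 ψ → HasCompactSupport ψ →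
      ∫ x, w₂ x * Real.exp (u x) * ψ x ^ 2 ≤ ∫ x, w₁ x * ‖gradient ψ x‖ ^ 2)
    (hφ : ContDiff ℝ 2 φ) (hφc : HasCompactSupport φ) {t : ℝ} (ht : 0 < t) (ht2 : t < 2) :
    (2 - t) / 4 * ∫ x, w₂ x * (Real.exp ((2 * t + 1) * u x) * φ x ^ 2)
      ≤ (1 + (2 - 3 * t) ^ 2 / (8 * t * (2 - t)))
        * ∫ x, w₁ x * (Real.exp (2 * t * u x) * ‖gradient φ x‖ ^ 2) := by
  set ψ : EuclideanSpace ℝ (Fin N) → ℝ := fun y => Real.exp (t * u y) * φ y with hψdef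
  have hψ : ContDiff ℝ 2 ψ := (contDiff_const.mul hu).exp.mul hφ
  have hψc : HasCompactSupport ψ := hφc.mul_left
  have hη : ContDiff ℝ 2 (fun y => ψ y ^ 2) := hψ.pow 2
  have hηc : HasCompactSupport (fun y => ψ y ^ 2) := by
    simp_rw [pow_two]
    exact hψc.mul_left
  have hV : ContDiff ℝ 1 (fun y => w₁ y • gradient u y) :=
    hw₁.smul (hu.gradient (by norm_num))
  have hψgrad : ∀ x, HasGradientAt ψ
      (Real.exp (t * u x) • (gradient φ x + (t * φ x) • gradient u x)) x := fun x =>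
    ((hu.differentiable two_ne_zero x).hasGradientAt).exp_mul t
      (hφ.differentiable two_ne_zero x).hasGradientAt
  have hηgrad : ∀ x, gradient (fun y => ψ y ^ 2) x = (2 * ψ x) • gradient ψ x := fun x => by
    rw [((hψgrad x).pow 2).gradient, (hψgrad x).gradient]
    norm_num
  have hexp : ∀ x, Real.exp (t * u x) ^ 2 = Real.exp (2 * t * u x) := fun x => by
    rw [← Real.exp_nat_mul]; push_cast; ring_nf
  have hexp' : ∀ x, Real.exp ((2 * t + 1) * u x) = Real.exp (u x) * Real.exp (t * u x) ^ 2 :=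
    fun x => by
      rw [hexp, ← Real.exp_add]; ring_nf
  have hI : ∫ x, w₂ x * (Real.exp ((2 * t + 1) * u x) * φ x ^ 2)
      = ∫ x, w₂ x * Real.exp (u x) * ψ x ^ 2 := by
    congr 1; ext x
    rw [hexp', hψdef]; ring
  have hgc : HasCompactSupport (fun x => ‖gradient φ x‖ ^ 2) :=
    (hφc.fderiv ℝ).comp_left (g := fun L =>
      ‖(InnerProductSpace.toDual ℝ (EuclideanSpace ℝ (Fin N))).symm L‖ ^ 2) (by simp)
  have hgψc : HasCompactSupport (fun x => ‖gradient ψ x‖ ^ 2) :=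
    (hψc.fderiv ℝ).comp_left (g := fun L =>
      ‖(InnerProductSpace.toDual ℝ (EuclideanSpace ℝ (Fin N))).symm L‖ ^ 2) (by simp)
  have hgφ : Continuous (gradient φ) := (hφ.gradient (m := 1) (by norm_num)).continuous
  have hgψ : Continuous (gradient ψ) := (hψ.gradient (m := 1) (by norm_num)).continuous
  have hgη : Continuous (gradient fun y => ψ y ^ 2) :=
    (hη.gradient (m := 1) (by norm_num)).continuous
  have hucont := hu.continuous
  have hw₁cont := hw₁.continuous
  have hK : Integrable (fun x => w₁ x * (Real.exp (2 * t * u x) * ‖gradient φ x‖ ^ 2)) :=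
    Continuous.integrable_of_hasCompactSupport (by fun_prop) hgc.mul_left.mul_left
  have hL : Integrable (fun x => w₁ x * ‖gradient ψ x‖ ^ 2) :=
    Continuous.integrable_of_hasCompactSupport (by fun_prop) hgψc.mul_left
  have hM : Integrable (fun x => ⟪w₁ x • gradient u x, gradient (fun y => ψ y ^ 2) x⟫) := by
    refine Continuous.integrable_of_hasCompactSupport (hV.continuous.inner hgη) ?_
    simp_rw [hηgrad, real_inner_smul_right, mul_assoc]
    exact (hψc.mul_right).mul_left
  have hS := hstab ψ hψ hψc
  have hA : ∫ x, ⟪w₁ x • gradient u x, gradient (fun y => ψ y ^ 2) x⟫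
      ≤ ∫ x, w₂ x * Real.exp (u x) * ψ x ^ 2 := by
    have h := hηc.integral_mul_vdiv (hη.of_le (by norm_num)) hV
    rw [eq_comm, neg_eq_iff_eq_neg, ← integral_neg] at h
    rw [h]
    refine integral_mono (Integrable.neg ?_) ?_ fun x => ?_
    · refine Continuous.integrable_of_hasCompactSupport (hη.continuous.mul ?_) hηc.mul_right
      have := hV.continuous_fderiv one_ne_zero
      exact ((LinearMap.trace ℝ (EuclideanSpace ℝ (Fin N))
        ∘ₗ ContinuousLinearMap.coeLM ℝ).continuous_of_finiteDimensional).comp this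
    · exact Continuous.integrable_of_hasCompactSupport
        ((hw₂.mul hucont.rexp).mul hη.continuous) hηc.mul_left
    · have := mul_le_mul_of_nonneg_right (hsub x) (sq_nonneg (ψ x))
      simp only
      linarith
  have hpt : ∀ x, w₁ x * ‖gradient ψ x‖ ^ 2
      ≤ (t + 2) / 4 * ⟪w₁ x • gradient u x, gradient (fun y => ψ y ^ 2) x⟫
        + (1 + (2 - 3 * t) ^ 2 / (8 * t * (2 - t)))
          * (w₁ x * (Real.exp (2 * t * u x) * ‖gradient φ x‖ ^ 2)) := by
    intro x
    have h := mul_le_mul_of_nonneg_left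
      (norm_add_smul_sq_le (φ x • gradient u x) (gradient φ x) ht ht2)
      (mul_nonneg (hw₁pos x) (sq_nonneg (Real.exp (t * u x))))
    rw [hηgrad, (hψgrad x).gradient, norm_smul, mul_pow, Real.norm_eq_abs, sq_abs,
      ← hexp]
    simp only [smul_smul, real_inner_smul_left, real_inner_smul_right] at h ⊢
    rw [← mul_assoc]
    refine h.trans (le_of_eq ?_)
    rw [hψdef]
    ring
  have hB : ∫ x, w₁ x * ‖gradient ψ x‖ ^ 2
      ≤ (t + 2) / 4 * (∫ x, ⟪w₁ x • gradient u x, gradient (fun y => ψ y ^ 2) x⟫)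
        + (1 + (2 - 3 * t) ^ 2 / (8 * t * (2 - t)))
          * ∫ x, w₁ x * (Real.exp (2 * t * u x) * ‖gradient φ x‖ ^ 2) := by
    rw [← integral_const_mul, ← integral_const_mul, ← integral_add (hM.const_mul _)
      (hK.const_mul _)]
    exact integral_mono hL ((hM.const_mul _).add (hK.const_mul _)) hpt
  rw [hI]
  nlinarith [mul_le_mul_of_nonneg_left hA (show 0 ≤ (t + 2) / 4 by linarith)]

theorem exists_cutoff (N : ℕ) : ∃ C : ℝ, 0 < C ∧ ∀ R : ℝ, 0 < R →
    ∃ χ : EuclideanSpace ℝ (Fin N) → ℝ, ContDiff ℝ 2 χ ∧ HasCompactSupport χ ∧ (∀ x, 0 ≤ χ x) ∧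
      (∀ x, χ x ≤ 1) ∧ (∀ x, ‖x‖ ≤ R → χ x = 1) ∧ (∀ x, 2 * R ≤ ‖x‖ → χ x = 0) ∧
      (∀ x, ‖gradient χ x‖ ≤ C / R) ∧ ∀ x, gradient χ x ≠ 0 → R ≤ ‖x‖ ∧ ‖x‖ ≤ 2 * R := by
  let f : ContDiffBump (0 : EuclideanSpace ℝ (Fin N)) := ⟨1, 2, one_pos, one_lt_two⟩
  have hf : ContDiff ℝ 2 f := f.contDiff
  have hfc : HasCompactSupport (gradient f) :=
    (f.hasCompactSupport.fderiv ℝ).comp_left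
      (g := fun L => (InnerProductSpace.toDual ℝ (EuclideanSpace ℝ (Fin N))).symm L) (by simp)
  obtain ⟨C, hC⟩ := hfc.exists_bound_of_continuous
    (hf.gradient (m := 1) (by norm_num)).continuous
  refine ⟨max C 1, by positivity, fun R hR => ?_⟩
  have hnorm : ∀ x : EuclideanSpace ℝ (Fin N), ‖R⁻¹ • x‖ = ‖x‖ / R := fun x => by
    rw [norm_smul, norm_inv, Real.norm_of_nonneg hR.le, div_eq_inv_mul]
  have hone : ∀ x, ‖x‖ ≤ R → f (R⁻¹ • x) = 1 := fun x hx => by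
    apply f.one_of_mem_closedBall
    rw [mem_closedBall_zero_iff, hnorm, div_le_iff₀ hR]
    simpa [f] using hx
  have hzero : ∀ x, 2 * R ≤ ‖x‖ → f (R⁻¹ • x) = 0 := fun x hx => by
    apply f.zero_of_le_dist
    rw [dist_zero_right, hnorm, le_div_iff₀ hR]
    exact hx
  have hgrad : ∀ x, gradient (fun y => f (R⁻¹ • y)) x = R⁻¹ • gradient f (R⁻¹ • x) := by
    intro x
    apply HasGradientAt.gradient
    have h := (hf.differentiable two_ne_zero (R⁻¹ • x)).hasGradientAt
    rw [hasGradientAt_iff_hasFDerivAt] at h ⊢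
    convert! h.comp x ((hasFDerivAt_id x).const_smul R⁻¹) using 1
    ext y
    simp
  refine ⟨fun x => f (R⁻¹ • x), hf.comp (contDiff_const_smul _), ?_, fun x => f.nonneg,
    fun x => f.le_one, hone, hzero, fun x => ?_, fun x hx => ⟨?_, ?_⟩⟩
  · refine HasCompactSupport.intro (isCompact_closedBall 0 (2 * R)) fun x hx => hzero x ?_
    rw [mem_closedBall_zero_iff] at hx
    linarith
  · rw [hgrad, norm_smul, norm_inv, Real.norm_of_nonneg hR.le, div_eq_inv_mul]
    gcongr
    exact (hC _).trans (le_max_left _ _)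
  · by_contra! h
    refine hx ?_
    have : (fun y => f (R⁻¹ • y)) =ᶠ[nhds x] fun _ => (1 : ℝ) := by
      filter_upwards [continuous_norm.continuousAt.eventually_lt_const h] with y hy
      exact hone y hy.le
    rw [this.gradient_eq, gradient_fun_const]
  · by_contra! h
    refine hx ?_
    have : (fun y => f (R⁻¹ • y)) =ᶠ[nhds x] fun _ => (0 : ℝ) := by
      filter_upwards [continuous_norm.continuousAt.eventually_const_lt h] with y hy
      exact hzero y hy.le
    rw [this.gradient_eq, gradient_fun_const]

theorem one_add_sq_rpow_bounds {r R : ℝ} (s : ℝ) (hR : 1 ≤ R) (h₁ : R ≤ r) (h₂ : r ≤ 2 * R) :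
    (1 + r ^ 2) ^ (s / 2) ≤ 5 ^ |s / 2| * R ^ s ∧
      5 ^ (-|s / 2|) * R ^ s ≤ (1 + r ^ 2) ^ (s / 2) := by
  have hR₀ : 0 < R := by linarith
  set q := (1 + r ^ 2) / R ^ 2 with hq
  have hq₁ : 1 ≤ q := by rw [hq, le_div_iff₀ (by positivity)]; nlinarith
  have hq₅ : q ≤ 5 := by rw [hq, div_le_iff₀ (by positivity)]; nlinarith
  have hfac : (1 + r ^ 2) ^ (s / 2) = q ^ (s / 2) * R ^ s := by
    rw [show 1 + r ^ 2 = q * R ^ 2 by rw [hq]; field_simp, Real.mul_rpow (by linarith)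
      (by positivity), ← Real.rpow_natCast R 2, ← Real.rpow_mul hR₀.le]
    congr 2
    push_cast
    ring
  rw [hfac]
  constructor
  · gcongr
    calc q ^ (s / 2) ≤ q ^ |s / 2| := Real.rpow_le_rpow_of_exponent_le hq₁ (le_abs_self _)
      _ ≤ 5 ^ |s / 2| := by gcongr
  · gcongr
    calc (5 : ℝ) ^ (-|s / 2|) ≤ q ^ (-|s / 2|) :=
          Real.rpow_le_rpow_of_nonpos (by linarith) hq₅ (by simp)
      _ ≤ q ^ (s / 2) := Real.rpow_le_rpow_of_exponent_le hq₁ (neg_abs_le _)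

theorem cutoff_energy_le {N : ℕ} {w₁ w₂ u χ : EuclideanSpace ℝ (Fin N) → ℝ}
    (hw₁ : ContDiff ℝ 1 w₁) (hw₁pos : ∀ x, 0 ≤ w₁ x) (hw₂ : Continuous w₂)
    (hw₂pos : ∀ x, 0 < w₂ x) (hu : ContDiff ℝ 2 u)
    (hsub : ∀ x, -vdiv (fun y => w₁ y • gradient u y) x ≤ w₂ x * Real.exp (u x))
    (hstab : ∀ ψ : EuclideanSpace ℝ (Fin N) → ℝ, ContDiff ℝ 2 ψ → HasCompactSupport ψ →
      ∫ x, w₂ x * Real.exp (u x) * ψ x ^ 2 ≤ ∫ x, w₁ x * ‖gradient ψ x‖ ^ 2)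
    {t : ℝ} (ht : 0 < t) (ht2 : t < 2) (hχ : ContDiff ℝ 2 χ) (hχc : HasCompactSupport χ)
    (hχ₀ : ∀ x, 0 ≤ χ x) (hχ₁ : ∀ x, χ x ≤ 1) {R D a b : ℝ} (ha : 0 ≤ a) (hb : 0 < b)
    (hgrad : ∀ x, ‖gradient χ x‖ ≤ D)
    (hw : ∀ x, gradient χ x ≠ 0 → ‖x‖ ≤ 2 * R ∧ w₁ x ≤ a ∧ b ≤ w₂ x) :
    (2 - t) / 8 * ∫ x, w₂ x * (Real.exp ((2 * t + 1) * u x) * χ x ^ 10)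
      ≤ volume.real (Metric.closedBall (0 : EuclideanSpace ℝ (Fin N)) (2 * R)) *
        ((1 + (2 - 3 * t) ^ 2 / (8 * t * (2 - t))) * 25 * (a * D ^ 2) *
        ((1 + (2 - 3 * t) ^ 2 / (8 * t * (2 - t))) * 25 * (a * D ^ 2) / ((2 - t) / 8 * b))
          ^ (2 * t)) := by
  have h2t : 0 < 2 - t := by linarith
  have h8 : 0 < (2 - t) / 8 := by linarith
  have hc : 0 ≤ (2 - 3 * t) ^ 2 / (8 * t * (2 - t)) := by positivity
  set c := 1 + (2 - 3 * t) ^ 2 / (8 * t * (2 - t)) with hcdef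
  have hc₀ : 0 < c := by linarith
  set Z := c * 25 * (a * D ^ 2) * (c * 25 * (a * D ^ 2) / ((2 - t) / 8 * b)) ^ (2 * t) with hZ
  have hφc : HasCompactSupport (fun x => χ x ^ 5) := by
    simp_rw [pow_succ _ 4]
    exact hχc.mul_left
  have hE := energy_estimate hw₁ hw₁pos hw₂ hu hsub hstab (hχ.pow 5) hφc ht ht2
  have hφgrad : ∀ x, ‖gradient (fun y => χ y ^ 5) x‖ ^ 2 = 25 * (χ x ^ 8 * ‖gradient χ x‖ ^ 2) := by
    intro x
    rw [((hχ.differentiable two_ne_zero x).hasGradientAt.pow 5).gradient, norm_smul, mul_pow,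
      Real.norm_eq_abs, sq_abs]
    push_cast
    ring
  simp_rw [hφgrad, ← pow_mul, ← hcdef] at hE
  norm_num only at hE
  have hucont := hu.continuous
  have hχcont := hχ.continuous
  have hw₁cont := hw₁.continuous
  have hgχ : Continuous (gradient χ) := (hχ.gradient (m := 1) (by norm_num)).continuous
  have hχc' : HasCompactSupport (fun x => χ x ^ 10) := by
    simp_rw [pow_succ _ 9]
    exact hχc.mul_left
  have hI : Integrable (fun x => w₂ x * (Real.exp ((2 * t + 1) * u x) * χ x ^ 10)) :=
    Continuous.integrable_of_hasCompactSupport (by fun_prop) hχc'.mul_left.mul_left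
  have hK : Integrable (fun x => w₁ x * (Real.exp (2 * t * u x) *
      (25 * (χ x ^ 8 * ‖gradient χ x‖ ^ 2)))) := by
    refine Continuous.integrable_of_hasCompactSupport (by fun_prop)
      (HasCompactSupport.mul_left (HasCompactSupport.mul_left (HasCompactSupport.mul_left
        (HasCompactSupport.mul_right ?_))))
    simp_rw [pow_succ _ 7]
    exact hχc.mul_left
  have hball : IntegrableOn (fun _ => Z)
      (Metric.closedBall (0 : EuclideanSpace ℝ (Fin N)) (2 * R)) :=
    integrableOn_const measure_closedBall_lt_top.ne
  rw [← integrable_indicator_iff measurableSet_closedBall] at hball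
  have hpt : ∀ x, c * (w₁ x * (Real.exp (2 * t * u x) * (25 * (χ x ^ 8 * ‖gradient χ x‖ ^ 2))))
      ≤ (2 - t) / 8 * (w₂ x * (Real.exp ((2 * t + 1) * u x) * χ x ^ 10))
        + (Metric.closedBall (0 : EuclideanSpace ℝ (Fin N)) (2 * R)).indicator (fun _ => Z) x := by
    intro x
    by_cases hx : gradient χ x = 0
    · have hI₀ : 0 ≤ (2 - t) / 8 * (w₂ x * (Real.exp ((2 * t + 1) * u x) * χ x ^ 10)) :=
        mul_nonneg h8.le (mul_nonneg (hw₂pos x).le (by have := hχ₀ x; positivity))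
      have hZ₀ : 0 ≤ (Metric.closedBall (0 : EuclideanSpace ℝ (Fin N)) (2 * R)).indicator
          (fun _ => Z) x := by
        refine Set.indicator_nonneg (fun _ _ => ?_) x
        positivity
      rw [hx]
      norm_num
      linarith
    · obtain ⟨hxR, hxa, hxb⟩ := hw x hx
      rw [Set.indicator_of_mem (mem_closedBall_zero_iff.2 hxR)]
      have hA : 0 ≤ c * 25 * (w₁ x * ‖gradient χ x‖ ^ 2) := by
        have := hw₁pos x
        positivity
      have h := mul_exp_mul_pow_le (v := u x) hA (mul_pos h8 (hw₂pos x)) (hχ₀ x) (hχ₁ x) ht ht2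
      have hle : c * 25 * (w₁ x * ‖gradient χ x‖ ^ 2) ≤ c * 25 * (a * D ^ 2) := by
        gcongr
        exact hgrad x
      have hZle : c * 25 * (w₁ x * ‖gradient χ x‖ ^ 2) *
          (c * 25 * (w₁ x * ‖gradient χ x‖ ^ 2) / ((2 - t) / 8 * w₂ x)) ^ (2 * t) ≤ Z := by
        have := hw₂pos x
        rw [hZ]
        gcongr
      calc _ = c * 25 * (w₁ x * ‖gradient χ x‖ ^ 2) * (Real.exp (2 * t * u x) * χ x ^ 8) := by
            ring
        _ ≤ _ := h
        _ ≤ _ := by rw [mul_assoc ((2 - t) / 8)]; gcongr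
  have hint := integral_mono (hK.const_mul c) ((hI.const_mul ((2 - t) / 8)).add hball) hpt
  simp only [Pi.add_apply] at hint
  rw [integral_add (hI.const_mul _) hball, integral_const_mul, integral_const_mul,
    integral_indicator_const _ measurableSet_closedBall, smul_eq_mul] at hint
  linarith

theorem stmt_15 (N : ℕ) (hN : 1 ≤ N) (α β : ℝ)
    (h1 : 0 < (N : ℝ) + α - 2) (h2 : (N : ℝ) + α - 2 < 4 * (β - α + 2))
    (g : EuclideanSpace ℝ (Fin N) → ℝ) (hg : ContDiff ℝ (⊤ : ℕ∞) g) (hgpos : ∀ x, 0 < g x)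
    (c : ℝ) (hc : 0 < c) (hglim : Tendsto g (cocompact (EuclideanSpace ℝ (Fin N))) (nhds c)) :
    ¬ ∃ u : EuclideanSpace ℝ (Fin N) → ℝ, ContDiff ℝ 2 u ∧
      (∀ x, -vdiv (fun y => (fun x : EuclideanSpace ℝ (Fin N) => (1 + ‖x‖^2) ^ (α/2)) y • gradient u y) x ≤ (fun x : EuclideanSpace ℝ (Fin N) => g x * (1 + ‖x‖^2) ^ (β/2)) x * Real.exp (u x)) ∧
      (∀ ψ : EuclideanSpace ℝ (Fin N) → ℝ, ContDiff ℝ 2 ψ → HasCompactSupport ψ →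
        ∫ x, (fun x : EuclideanSpace ℝ (Fin N) => g x * (1 + ‖x‖^2) ^ (β/2)) x * Real.exp (u x) * ψ x ^ 2 ≤ ∫ x, (fun x : EuclideanSpace ℝ (Fin N) => (1 + ‖x‖^2) ^ (α/2)) x * ‖gradient ψ x‖ ^ 2) := by
  rintro ⟨u, hu, hsub, hstab⟩
  obtain ⟨t, ht, ht2, hexp⟩ : ∃ t : ℝ, 0 < t ∧ t < 2 ∧
      (N : ℝ) + α - 2 - 2 * t * (β - α + 2) < 0 := by
    have hb : 0 < β - α + 2 := by linarith
    have hlt : ((N : ℝ) + α - 2) / (2 * (β - α + 2)) < 2 := by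
      rw [div_lt_iff₀ (by positivity)]
      linarith
    obtain ⟨t, h, ht2⟩ := exists_between hlt
    have hpos : 0 < ((N : ℝ) + α - 2) / (2 * (β - α + 2)) := by positivity
    refine ⟨t, hpos.trans h, ht2, ?_⟩
    rw [div_lt_iff₀ (by positivity)] at h
    linarith
  have hbase : ∀ x : EuclideanSpace ℝ (Fin N), 0 < 1 + ‖x‖ ^ 2 := fun x => by positivity
  have hsmooth : ContDiff ℝ 1 fun x : EuclideanSpace ℝ (Fin N) => 1 + ‖x‖ ^ 2 :=
    contDiff_const.add (contDiff_norm_sq ℝ)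
  set w₁ : EuclideanSpace ℝ (Fin N) → ℝ := fun x => (1 + ‖x‖ ^ 2) ^ (α / 2)
  set w₂ : EuclideanSpace ℝ (Fin N) → ℝ := fun x => g x * (1 + ‖x‖ ^ 2) ^ (β / 2)
  have hw₁ : ContDiff ℝ 1 w₁ := hsmooth.rpow_const_of_ne fun x => (hbase x).ne'
  have hw₁pos : ∀ x, 0 ≤ w₁ x := fun x => (Real.rpow_pos_of_pos (hbase x) _).le
  have hw₂ : Continuous w₂ :=
    hg.continuous.mul (hsmooth.rpow_const_of_ne fun x => (hbase x).ne').continuous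
  have hw₂pos : ∀ x, 0 < w₂ x := fun x => mul_pos (hgpos x) (Real.rpow_pos_of_pos (hbase x) _)
  obtain ⟨R₀, hR₀⟩ : ∃ R₀ : ℝ, ∀ x : EuclideanSpace ℝ (Fin N), R₀ ≤ ‖x‖ → c / 2 ≤ g x := by
    have h := hglim.eventually (lt_mem_nhds (half_lt_self hc))
    rw [← Metric.cobounded_eq_cocompact, ← comap_norm_atTop, eventually_comap] at h
    obtain ⟨R₀, h⟩ := eventually_atTop.1 h
    exact ⟨R₀, fun x hx => (h _ hx x rfl).le⟩
  obtain ⟨C, hC, hcut⟩ := exists_cutoff N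
  obtain ⟨χ₀, hχ₀, hχ₀c, hχ₀nn, hχ₀le, hχ₀one, hχ₀zero, -, -⟩ := hcut (1 / 2) (by norm_num)
  set I₀ := ∫ x, w₂ x * (Real.exp ((2 * t + 1) * u x) * χ₀ x ^ 10)
  have hucont := hu.continuous
  have hint : ∀ χ : EuclideanSpace ℝ (Fin N) → ℝ, ContDiff ℝ 2 χ → HasCompactSupport χ →
      Continuous (fun x => w₂ x * (Real.exp ((2 * t + 1) * u x) * χ x ^ 10)) ∧
        HasCompactSupport (fun x => w₂ x * (Real.exp ((2 * t + 1) * u x) * χ x ^ 10)) := by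
    intro χ hχ hχc
    have := hχ.continuous
    refine ⟨by fun_prop, HasCompactSupport.mul_left (HasCompactSupport.mul_left ?_)⟩
    simp_rw [pow_succ _ 9]
    exact hχc.mul_left
  have hI₀pos : 0 < I₀ := by
    refine (hint χ₀ hχ₀ hχ₀c).1.integral_pos_of_hasCompactSupport_nonneg_nonzero
      (hint χ₀ hχ₀ hχ₀c).2 (fun x => ?_) (x := 0) ?_
    · exact mul_nonneg (hw₂pos x).le (by have := hχ₀nn x; positivity)
    · rw [hχ₀one 0 (by norm_num)]
      exact (mul_pos (hw₂pos 0) (by positivity)).ne'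
  set k := 1 + (2 - 3 * t) ^ 2 / (8 * t * (2 - t))
  set q := k * 25 * (5 ^ |α / 2| * C ^ 2) with hq
  set p := (2 - t) / 8 * (c / 2 * 5 ^ (-|β / 2|)) with hp
  have h2t : 0 < 2 - t := by linarith
  have hk : 0 < k := by positivity
  have hq₀ : 0 < q := by positivity
  have hp₀ : 0 < p := by positivity
  set M := 2 ^ N * volume.real (Metric.ball (0 : EuclideanSpace ℝ (Fin N)) 1) *
    (q * (q / p) ^ (2 * t)) with hM
  have hbound : ∀ R : ℝ, max R₀ 1 ≤ R →
      (2 - t) / 8 * I₀ ≤ M * R ^ ((N : ℝ) + α - 2 - 2 * t * (β - α + 2)) := by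
    intro R hR
    have hR₁ : 1 ≤ R := (le_max_right _ _).trans hR
    have hRpos : 0 < R := by linarith
    obtain ⟨χ, hχ, hχc, hχnn, hχle, hχone, hχzero, hχgrad, hχsupp⟩ := hcut R hRpos
    have hmono : I₀ ≤ ∫ x, w₂ x * (Real.exp ((2 * t + 1) * u x) * χ x ^ 10) := by
      refine integral_mono
        ((hint χ₀ hχ₀ hχ₀c).1.integrable_of_hasCompactSupport (hint χ₀ hχ₀ hχ₀c).2)
        ((hint χ hχ hχc).1.integrable_of_hasCompactSupport (hint χ hχ hχc).2) fun x => ?_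
      refine mul_le_mul_of_nonneg_left (mul_le_mul_of_nonneg_left
        (pow_le_pow_left₀ (hχ₀nn x) ?_ 10) (Real.exp_nonneg _)) (hw₂pos x).le
      rcases le_total ‖x‖ R with hx | hx
      · exact (hχ₀le x).trans_eq (hχone x hx).symm
      · rw [hχ₀zero x (by linarith)]
        exact hχnn x
    have hmain := cutoff_energy_le (a := 5 ^ |α / 2| * R ^ α)
      (b := c / 2 * (5 ^ (-|β / 2|) * R ^ β)) (R := R) hw₁ hw₁pos hw₂ hw₂pos hu hsub hstab ht ht2
      hχ hχc hχnn hχle (by positivity) (by positivity) hχgrad fun x hx => by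
        obtain ⟨hx₁, hx₂⟩ := hχsupp x hx
        refine ⟨hx₂, (one_add_sq_rpow_bounds α hR₁ hx₁ hx₂).1, ?_⟩
        exact mul_le_mul (hR₀ x (((le_max_left _ _).trans hR).trans hx₁))
          (one_add_sq_rpow_bounds β hR₁ hx₁ hx₂).2 (by positivity) (hgpos x).le
    refine (mul_le_mul_of_nonneg_left hmono (by positivity)).trans (hmain.trans_eq ?_)
    have hRα : R ^ α * (C / R) ^ 2 = C ^ 2 * R ^ (α - 2) := by
      rw [Real.rpow_sub hRpos, Real.rpow_two]
      field_simp
    have hnum : k * 25 * (5 ^ |α / 2| * R ^ α * (C / R) ^ 2) = q * R ^ (α - 2) := by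
      rw [mul_assoc (5 ^ |α / 2|), hRα, hq]
      ring
    have hden : (2 - t) / 8 * (c / 2 * (5 ^ (-|β / 2|) * R ^ β)) = p * R ^ β := by
      rw [hp]
      ring
    have hquot : (q * R ^ (α - 2) / (p * R ^ β)) ^ (2 * t)
        = (q / p) ^ (2 * t) * R ^ ((α - 2 - β) * (2 * t)) := by
      rw [mul_div_mul_comm, ← Real.rpow_sub hRpos, Real.mul_rpow (by positivity) (by positivity),
        ← Real.rpow_mul hRpos.le]
    have hpow : R ^ ((N : ℝ) + α - 2 - 2 * t * (β - α + 2))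
        = R ^ N * R ^ (α - 2) * R ^ ((α - 2 - β) * (2 * t)) := by
      rw [← Real.rpow_natCast, ← Real.rpow_add hRpos, ← Real.rpow_add hRpos]
      ring_nf
    rw [hnum, hden, hquot, Measure.addHaar_real_closedBall _ _ (by positivity),
      finrank_euclideanSpace_fin, mul_pow, hpow, hM]
    ring
  have hlim : Tendsto (fun R : ℝ => M * R ^ ((N : ℝ) + α - 2 - 2 * t * (β - α + 2))) atTop
      (nhds 0) := by
    have := (tendsto_rpow_neg_atTop (neg_pos.2 hexp)).const_mul M
    simpa only [neg_neg, mul_zero] using this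
  have := ge_of_tendsto hlim (eventually_atTop.2 ⟨max R₀ 1, hbound⟩)
  have : 0 < (2 - t) / 8 * I₀ := by positivity
  linarith
end

section
/- Let N ≥ 1, p > 1, and α, β ∈ ℝ with N + α − 2 > 0 and N + α − 2 < (2(β − α + 2)/(p − 1))(p + √(p(p−1))). Let ω₁(x) = (1 + |x|²)^{α/2} and ω₂(x) = g(x)(1 + |x|²)^{β/2}, where g : ℝ^N → ℝ is a smooth positive function with lim_{|x|→∞} g(x) = c for some constant c ∈ (0, ∞). Then there is no positive stable sub-solution of the equation −div(ω₁ ∇u) = ω₂ u^p in ℝ^N. -/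
open MeasureTheory Filter Real
open scoped RealInnerProductSpace

section

variable {N : ℕ}

local notation "E" => EuclideanSpace ℝ (Fin N)

lemma vdiv_eq_sum (V : E → E) (hV : Differentiable ℝ V) (x : E) :
    vdiv V x = ∑ i, fderiv ℝ (fun y => V y i) x (EuclideanSpace.single i 1) := by
  unfold vdiv
  rw [LinearMap.trace_eq_sum_inner _ (EuclideanSpace.basisFun (Fin N) ℝ)]
  refine Finset.sum_congr rfl fun i _ => ?_
  have h : HasFDerivAt (fun y => V y i)
      ((EuclideanSpace.proj i : E →L[ℝ] ℝ).comp (fderiv ℝ V x)) x :=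
    (EuclideanSpace.proj i : E →L[ℝ] ℝ).hasFDerivAt.comp x (hV x).hasFDerivAt
  rw [h.fderiv]
  simp [EuclideanSpace.inner_single_left]

lemma continuous_vdiv {V : E → E} (hV : ContDiff ℝ 1 V) : Continuous (vdiv V) := by
  rw [funext (vdiv_eq_sum V (hV.differentiable one_ne_zero))]
  refine continuous_finsetSum _ fun i _ => ?_
  exact ((((EuclideanSpace.proj i : E →L[ℝ] ℝ).contDiff.comp hV).continuous_fderiv
    one_ne_zero).clm_apply continuous_const)

lemma contDiff_gradient {f : E → ℝ} {n : WithTop ℕ∞} (hf : ContDiff ℝ (n + 1) f) :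
    ContDiff ℝ n (gradient f) :=
  (InnerProductSpace.toDual ℝ E).symm.contDiff.comp (hf.fderiv_right le_rfl)

lemma HasFDerivAt.gradient_eq_smul_add_smul {f u v : E → ℝ} {x : E} {c d : ℝ}
    (h : HasFDerivAt f (c • fderiv ℝ u x + d • fderiv ℝ v x) x) :
    gradient f x = c • gradient u x + d • gradient v x := by
  simp [gradient, h.fderiv, map_add]

lemma integral_mul_vdiv_eq_neg {η : E → ℝ} {V : E → E} (hη : ContDiff ℝ 1 η)
    (hc : HasCompactSupport η) (hV : ContDiff ℝ 1 V) :
    ∫ x, η x * vdiv V x = - ∫ x, ⟪gradient η x, V x⟫ := by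
  have hVi (i : Fin N) : ContDiff ℝ 1 (fun y => V y i) :=
    (EuclideanSpace.proj i : E →L[ℝ] ℝ).contDiff.comp hV
  have hdη (i : Fin N) : Continuous fun x => fderiv ℝ η x (EuclideanSpace.single i 1) :=
    (hη.continuous_fderiv one_ne_zero).clm_apply continuous_const
  have hdc (i : Fin N) :
      HasCompactSupport fun x => fderiv ℝ η x (EuclideanSpace.single i 1) :=
    hc.fderiv_apply ℝ _
  have hdV (i : Fin N) :
      Continuous fun x => fderiv ℝ (fun y => V y i) x (EuclideanSpace.single i 1) :=
    ((hVi i).continuous_fderiv one_ne_zero).clm_apply continuous_const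
  have i1 (i : Fin N) : Integrable
      fun x => η x * fderiv ℝ (fun y => V y i) x (EuclideanSpace.single i 1) :=
    (hη.continuous.mul (hdV i)).integrable_of_hasCompactSupport hc.mul_right
  have i2 (i : Fin N) : Integrable
      fun x => fderiv ℝ η x (EuclideanSpace.single i 1) * V x i :=
    ((hdη i).mul (hVi i).continuous).integrable_of_hasCompactSupport (hdc i).mul_right
  have e1 (x : E) : η x * vdiv V x =
      ∑ i, η x * fderiv ℝ (fun y => V y i) x (EuclideanSpace.single i 1) := by
    rw [vdiv_eq_sum V (hV.differentiable one_ne_zero), Finset.mul_sum]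
  have e2 (x : E) : ⟪gradient η x, V x⟫ =
      ∑ i, fderiv ℝ η x (EuclideanSpace.single i 1) * V x i := by
    rw [inner_gradient_left]
    conv_lhs => rw [← (EuclideanSpace.basisFun (Fin N) ℝ).sum_repr (V x)]
    simp [map_sum, mul_comm]
  simp_rw [e1, e2]
  rw [integral_finsetSum _ fun i _ => i1 i, integral_finsetSum _ fun i _ => i2 i,
    ← Finset.sum_neg_distrib]
  refine Finset.sum_congr rfl fun i _ => ?_
  exact integral_mul_fderiv_eq_neg_fderiv_mul_of_integrable (i2 i) (i1 i)
    ((hη.continuous.mul (hVi i).continuous).integrable_of_hasCompactSupport hc.mul_right)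
    (fun x _ => hη.differentiable one_ne_zero x)
    (fun x _ => (hVi i).differentiable one_ne_zero x)

/-- The constant-chasing step of the Caccioppoli-type estimate: `X`, `Y`, `Z`, `F` stand for the
gradient, cross, cutoff and nonlinear integrals. -/
lemma exists_const_of_stability_bounds {p t : ℝ} (ht : 1 < t) (hD : t ^ 2 < p * (2 * t - 1)) :
    ∃ K > 0, ∀ X Y Z F : ℝ, 0 ≤ X → 0 ≤ Z → (∀ ε > 0, 2 * |Y| ≤ ε * X + ε⁻¹ * Z) →
      (2 * t - 1) * X + 2 * Y ≤ F → p * F ≤ t ^ 2 * X + 2 * t * Y + Z → F ≤ K * Z := by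
  set D := p * (2 * t - 1) - t ^ 2 with hDdef
  have hD0 : 0 < D := by linarith
  have ht1 : 0 < t * (t - 1) := by nlinarith
  set ε := min (2 * t - 2) (D / (2 * (t * (t - 1)))) with hε
  have hε0 : 0 < ε := lt_min (by linarith) (by positivity)
  have hε1 : ε ≤ 2 * t - 2 := min_le_left _ _
  have hε2 : t * (t - 1) * ε ≤ D / 2 := by
    have := min_le_right (2 * t - 2) (D / (2 * (t * (t - 1))))
    rw [← hε, le_div_iff₀ (by positivity)] at this
    linarith
  set B := t * (t - 1) * (ε * ε⁻¹ + ε⁻¹) + (2 * t - 1) with hB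
  have hB0 : 0 < B := by
    have : 0 < 2 * t - 1 := by linarith
    positivity
  refine ⟨2 * B / D, by positivity, fun X Y Z F hX hZ hY h1 h2 => ?_⟩
  have hY' := hY ε hε0
  have hY1 : -|Y| ≤ Y := neg_abs_le Y
  have hY2 : Y ≤ |Y| := le_abs_self Y
  have hXF : X ≤ F + ε⁻¹ * Z := by nlinarith
  have hF : 0 ≤ F + ε⁻¹ * Z := hX.trans hXF
  have key : D * F ≤ t * (t - 1) * (2 * Y) + (2 * t - 1) * Z := by
    nlinarith [mul_le_mul_of_nonneg_left h2 (show 0 ≤ 2 * t - 1 by linarith),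
      mul_le_mul_of_nonneg_left h1 (sq_nonneg t)]
  have h3 : 2 * Y ≤ ε * (F + ε⁻¹ * Z) + ε⁻¹ * Z := by
    nlinarith [mul_le_mul_of_nonneg_left hXF hε0.le]
  have h4 := mul_le_mul_of_nonneg_left h3 ht1.le
  have hF' : D * F ≤ t * (t - 1) * ε * F + B * Z := by rw [hB]; nlinarith
  rw [div_mul_eq_mul_div, le_div_iff₀ hD0]
  rcases le_or_gt 0 F with hF0 | hF0
  · nlinarith [mul_le_mul_of_nonneg_right hε2 hF0]
  · nlinarith [mul_nonneg hB0.le hZ]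

lemma exists_exponent {p n d : ℝ} (hp : 1 < p) (hn : 0 < n)
    (h : n < 2 * d / (p - 1) * (p + √(p * (p - 1)))) :
    ∃ t, 1 < t ∧ t ^ 2 < p * (2 * t - 1) ∧ n < 2 * t / (p - 1) * d := by
  set s := √(p * (p - 1))
  have hs : 0 < s := Real.sqrt_pos.2 (by nlinarith)
  have hs2 : s ^ 2 = p * (p - 1) := Real.sq_sqrt (by nlinarith)
  have hp1 : 0 < p - 1 := by linarith
  have hd : 0 < d := by
    by_contra! hd
    have : 2 * d / (p - 1) * (p + s) ≤ 0 :=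
      mul_nonpos_of_nonpos_of_nonneg (div_nonpos_of_nonpos_of_nonneg (by linarith) hp1.le)
        (by linarith)
    linarith
  set τ := n * (p - 1) / (2 * d) with hτ
  have hτT : τ < p + s := by
    rw [hτ, div_lt_iff₀ (by positivity)]
    rw [div_mul_eq_mul_div, lt_div_iff₀ hp1] at h
    linarith
  have hlt : max p ((τ + (p + s)) / 2) < p + s := max_lt (by linarith) (by linarith)
  have hle : p ≤ max p ((τ + (p + s)) / 2) := le_max_left _ _
  have hτt : τ < max p ((τ + (p + s)) / 2) := lt_max_of_lt_right (by linarith)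
  set t := max p ((τ + (p + s)) / 2)
  refine ⟨t, by linarith, by nlinarith, ?_⟩
  rw [hτ, div_lt_iff₀ (by positivity)] at hτt
  rw [div_mul_eq_mul_div, lt_div_iff₀ hp1]
  linarith

/-- A stable positive sub-solution satisfies a Caccioppoli-type estimate in which the gradient of
the solution no longer appears. -/
lemma exists_caccioppoli_const {p t : ℝ} (ht : 1 < t) (hD : t ^ 2 < p * (2 * t - 1))
    {a b u : E → ℝ} (ha : ContDiff ℝ 1 a) (ha0 : ∀ x, 0 ≤ a x) (hb : Continuous b)
    (hu : ContDiff ℝ 2 u) (hu0 : ∀ x, 0 < u x)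
    (hsub : ∀ x, -vdiv (fun y => a y • gradient u y) x ≤ b x * u x ^ p)
    (hstab : ∀ ψ : E → ℝ, ContDiff ℝ 2 ψ → HasCompactSupport ψ →
      ∫ x, p * b x * u x ^ (p - 1) * ψ x ^ 2 ≤ ∫ x, a x * ‖gradient ψ x‖ ^ 2) :
    ∃ K > 0, ∀ φ : E → ℝ, ContDiff ℝ 2 φ → HasCompactSupport φ →
      ∫ x, b x * u x ^ (p - 1) * (u x ^ t * φ x) ^ 2 ≤
        K * ∫ x, a x * (u x ^ t) ^ 2 * ‖gradient φ x‖ ^ 2 := by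
  obtain ⟨K, hK, hKb⟩ := exists_const_of_stability_bounds ht hD
  refine ⟨K, hK, fun φ hφ hφc => ?_⟩
  have hr (s : ℝ) : ContDiff ℝ 2 fun x => u x ^ s := hu.rpow_const_of_ne fun x => (hu0 x).ne'
  have hrc (s : ℝ) : Continuous fun x => u x ^ s := (hr s).continuous
  have hgu : ContDiff ℝ 1 (gradient u) := contDiff_gradient hu
  have hgφ : Continuous (gradient φ) := (contDiff_gradient (n := 1) hφ).continuous
  have hφ' := hφ.continuous
  have hu' (x : E) : HasFDerivAt u (fderiv ℝ u x) x :=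
    (hu.differentiable two_ne_zero x).hasFDerivAt
  have hφd (x : E) : HasFDerivAt φ (fderiv ℝ φ x) x :=
    (hφ.differentiable two_ne_zero x).hasFDerivAt
  have hpt (x : E) : u x ^ t = u x ^ (t - 1) * u x := by
    rw [rpow_sub_one (hu0 x).ne', div_mul_cancel₀ _ (hu0 x).ne']
  have hp2t (x : E) : u x ^ (2 * t - 1) = u x ^ t * u x ^ (t - 1) := by
    rw [← rpow_add (hu0 x)]; ring_nf
  have hpp (x : E) : u x ^ p = u x ^ (p - 1) * u x := by
    rw [rpow_sub_one (hu0 x).ne', div_mul_cancel₀ _ (hu0 x).ne']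
  have hψg (x : E) : gradient (fun x => u x ^ t * φ x) x =
      (t * u x ^ (t - 1) * φ x) • gradient u x + (u x ^ t) • gradient φ x := by
    apply HasFDerivAt.gradient_eq_smul_add_smul
    refine (((hu' x).rpow_const (p := t) (Or.inl (hu0 x).ne')).mul (hφd x)).congr_fderiv ?_
    ext v; simp; ring
  have hηg (x : E) : gradient (fun x => u x ^ (2 * t - 1) * φ x ^ 2) x =
      ((2 * t - 1) * (u x ^ (t - 1)) ^ 2 * φ x ^ 2) • gradient u x +
        (2 * (u x ^ t * u x ^ (t - 1) * φ x)) • gradient φ x := by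
    apply HasFDerivAt.gradient_eq_smul_add_smul
    refine (((hu' x).rpow_const (p := 2 * t - 1) (Or.inl (hu0 x).ne')).mul
      ((hφd x).pow 2)).congr_fderiv ?_
    have h : u x ^ (2 * t - 1 - 1) = (u x ^ (t - 1)) ^ 2 := by
      rw [← rpow_mul_natCast (hu0 x).le]; push_cast; ring_nf
    ext v; simp [h, hp2t]; ring
  set X : E → ℝ := fun x => a x * (u x ^ (t - 1)) ^ 2 * φ x ^ 2 * ‖gradient u x‖ ^ 2 with hX
  set Y : E → ℝ := fun x => a x * (u x ^ t * u x ^ (t - 1) * φ x) * ⟪gradient u x, gradient φ x⟫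
    with hY
  set Z : E → ℝ := fun x => a x * (u x ^ t) ^ 2 * ‖gradient φ x‖ ^ 2 with hZ
  set F : E → ℝ := fun x => b x * u x ^ (p - 1) * (u x ^ t * φ x) ^ 2 with hF
  have ha' := ha.continuous
  have hgu' := hgu.continuous
  have hφ0 {x : E} (h : x ∉ tsupport φ) : φ x = 0 := image_eq_zero_of_notMem_tsupport h
  have hgφ0 {x : E} (h : x ∉ tsupport φ) : gradient φ x = 0 := by
    have : fderiv ℝ φ x = 0 := by
      by_contra h'
      exact h (support_fderiv_subset ℝ h')
    simp [gradient, this]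
  have iX : Integrable X := by
    refine Continuous.integrable_of_hasCompactSupport (by fun_prop) (.intro hφc fun x hx => ?_)
    simp [hX, hφ0 hx]
  have iY : Integrable Y := by
    refine Continuous.integrable_of_hasCompactSupport (by fun_prop) (.intro hφc fun x hx => ?_)
    simp [hY, hφ0 hx]
  have iZ : Integrable Z := by
    refine Continuous.integrable_of_hasCompactSupport (by fun_prop) (.intro hφc fun x hx => ?_)
    simp [hZ, hgφ0 hx]
  have iF : Integrable F := by
    refine Continuous.integrable_of_hasCompactSupport (by fun_prop) (.intro hφc fun x hx => ?_)
    simp [hF, hφ0 hx]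
  have hX0 (x : E) : 0 ≤ X x := by have := ha0 x; positivity
  have hZ0 (x : E) : 0 ≤ Z x := by have := ha0 x; positivity
  apply hKb (∫ x, X x) (∫ x, Y x) (∫ x, Z x) (∫ x, F x) (integral_nonneg hX0) (integral_nonneg hZ0)
  · intro ε hε
    have hYpt (x : E) : |Y x| ≤ (ε / 2) * X x + (ε⁻¹ / 2) * Z x := by
      have hin := abs_real_inner_le_norm (gradient u x) (gradient φ x)
      set A := u x ^ (t - 1) * |φ x| * ‖gradient u x‖ with hA
      set C := u x ^ t * ‖gradient φ x‖ with hC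
      have hq : 0 ≤ u x ^ (t - 1) := (rpow_pos_of_pos (hu0 x) _).le
      have hq' : 0 ≤ u x ^ t := (rpow_pos_of_pos (hu0 x) _).le
      have h1 : |Y x| ≤ a x * (A * C) := by
        simp only [hY, abs_mul, abs_of_nonneg (ha0 x), abs_of_nonneg hq, abs_of_nonneg hq']
        rw [hA, hC]
        calc _ ≤ a x * (u x ^ t * u x ^ (t - 1) * |φ x|) *
              (‖gradient u x‖ * ‖gradient φ x‖) := by
                have := ha0 x
                gcongr
          _ = _ := by ring
      have hXA : X x = a x * A ^ 2 := by
        simp only [hX, hA, mul_pow, sq_abs]; ring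
      have hZC : Z x = a x * C ^ 2 := by simp only [hZ, hC]; ring
      have h2 : A * C ≤ (ε / 2) * A ^ 2 + (ε⁻¹ / 2) * C ^ 2 := by
        have : (ε / 2) * A ^ 2 + (ε⁻¹ / 2) * C ^ 2 - A * C = (ε⁻¹ / 2) * (ε * A - C) ^ 2 := by
          field_simp; ring
        have : 0 ≤ (ε⁻¹ / 2) * (ε * A - C) ^ 2 := by positivity
        linarith
      rw [hXA, hZC]
      nlinarith [mul_le_mul_of_nonneg_left h2 (ha0 x)]
    have h4 : |∫ x, Y x| ≤ (ε / 2) * (∫ x, X x) + (ε⁻¹ / 2) * ∫ x, Z x := by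
      rw [← integral_const_mul, ← integral_const_mul,
        ← integral_add (iX.const_mul _) (iZ.const_mul _)]
      exact (abs_integral_le_integral_abs).trans
        (integral_mono iY.abs ((iX.const_mul _).add (iZ.const_mul _)) hYpt)
    linarith
  · have hη : ContDiff ℝ 2 fun x => u x ^ (2 * t - 1) * φ x ^ 2 := (hr _).mul (hφ.pow 2)
    have hηc : HasCompactSupport fun x => u x ^ (2 * t - 1) * φ x ^ 2 :=
      .intro hφc fun x hx => by simp [hφ0 hx]
    have hV : ContDiff ℝ 1 fun y => a y • gradient u y := ha.smul hgu
    have h1 := integral_mul_vdiv_eq_neg (hη.of_le one_le_two) hηc hV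
    have h2 : ∀ x, ⟪gradient (fun x => u x ^ (2 * t - 1) * φ x ^ 2) x, a x • gradient u x⟫ =
        (2 * t - 1) * X x + 2 * Y x := fun x => by
      rw [hηg, inner_add_left, inner_smul_left, inner_smul_left, inner_smul_right,
        inner_smul_right, real_inner_self_eq_norm_sq, real_inner_comm]
      simp only [hX, hY, conj_trivial]
      ring
    simp_rw [h2] at h1
    rw [← integral_const_mul, ← integral_const_mul,
      ← integral_add (iX.const_mul _) (iY.const_mul _), ← neg_neg (∫ x, _ + _), ← h1,
      ← integral_neg]
    refine integral_mono ?_ iF fun x => ?_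
    · refine (Continuous.integrable_of_hasCompactSupport (hη.continuous.mul
        (continuous_vdiv hV)) hηc.mul_right).neg
    · have h3 : 0 ≤ u x ^ (2 * t - 1) * φ x ^ 2 :=
        mul_nonneg (rpow_pos_of_pos (hu0 x) _).le (sq_nonneg _)
      have h4 := mul_le_mul_of_nonneg_left (hsub x) h3
      simp only [hF]
      calc _ = u x ^ (2 * t - 1) * φ x ^ 2 * -vdiv (fun y => a y • gradient u y) x := by ring
        _ ≤ _ := h4
        _ = _ := by rw [hp2t, hpp, hpt]; ring
  · have h1 := hstab (fun x => u x ^ t * φ x) ((hr t).mul hφ)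
      (.intro hφc fun x hx => by simp [hφ0 hx])
    have h2 : ∀ x, a x * ‖gradient (fun x => u x ^ t * φ x) x‖ ^ 2 =
        t ^ 2 * X x + 2 * t * Y x + Z x := fun x => by
      rw [hψg, norm_add_sq_real, inner_smul_left, inner_smul_right, norm_smul, norm_smul,
        mul_pow, mul_pow, Real.norm_eq_abs, Real.norm_eq_abs, sq_abs, sq_abs]
      simp only [hX, hY, hZ, conj_trivial]
      ring
    have h3 : Integrable fun x => t ^ 2 * X x + 2 * t * Y x :=
      (iX.const_mul _).add (iY.const_mul _)
    simp_rw [h2] at h1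
    rw [integral_add h3 iZ,
      integral_add (iX.const_mul _) (iY.const_mul _), integral_const_mul, integral_const_mul] at h1
    rw [← integral_const_mul]
    refine le_trans (le_of_eq ?_) h1
    congr 1 with x
    simp only [hF]; ring

lemma exists_cutoff_family : ∃ G : ℝ, ∀ R > 0, ∃ χ : E → ℝ, ContDiff ℝ 2 χ ∧
    HasCompactSupport χ ∧ (∀ x, 0 ≤ χ x) ∧ (∀ x, χ x ≤ 1) ∧ (∀ x, ‖x‖ ≤ R → χ x = 1) ∧
    (∀ x, ‖gradient χ x‖ ≤ G / R) ∧
    ∀ x, gradient χ x ≠ 0 → R ≤ ‖x‖ ∧ ‖x‖ ≤ 2 * R := by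
  let f : ContDiffBump (0 : E) := ⟨1, 2, one_pos, one_lt_two⟩
  have hf : ContDiff ℝ 2 f := f.contDiff
  obtain ⟨G, hG⟩ := (f.hasCompactSupport.fderiv ℝ).exists_bound_of_continuous
    (hf.continuous_fderiv two_ne_zero)
  refine ⟨G, fun R hR => ?_⟩
  have hd (x : E) : HasFDerivAt (fun x : E => f (R⁻¹ • x)) (R⁻¹ • fderiv ℝ f (R⁻¹ • x)) x := by
    have h1 : HasFDerivAt (fun x : E => R⁻¹ • x) (R⁻¹ • ContinuousLinearMap.id ℝ E) x :=
      (hasFDerivAt_id x).const_smul R⁻¹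
    refine ((hf.differentiable two_ne_zero (R⁻¹ • x)).hasFDerivAt.comp x h1).congr_fderiv ?_
    ext v; simp
  have hn (x : E) : ‖R⁻¹ • x‖ = ‖x‖ / R := by
    rw [norm_smul, norm_inv, Real.norm_of_nonneg hR.le, inv_mul_eq_div]
  refine ⟨fun x => f (R⁻¹ • x), hf.comp (contDiff_const_smul _), ?_, fun x => f.nonneg,
    fun x => f.le_one, fun x hx => ?_, fun x => ?_, fun x hx => ?_⟩
  · exact f.hasCompactSupport.comp_smul (inv_ne_zero hR.ne')
  · apply f.one_of_mem_closedBall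
    rw [mem_closedBall_zero_iff, hn]
    exact (div_le_one hR).2 hx
  · rw [gradient, LinearIsometryEquiv.norm_map, (hd x).fderiv, norm_smul, norm_inv,
      Real.norm_of_nonneg hR.le, inv_mul_eq_div]
    gcongr
    exact hG _
  · have h0 : fderiv ℝ f (R⁻¹ • x) ≠ 0 := fun h => hx (by simp [gradient, (hd x).fderiv, h])
    constructor
    · by_contra! h
      refine h0 ?_
      have h1 : R⁻¹ • x ∈ Metric.ball (0 : E) f.rIn := by
        rw [mem_ball_zero_iff, hn]
        exact (div_lt_one hR).2 h
      rw [(f.eventuallyEq_one_of_mem_ball h1).fderiv_eq]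
      exact fderiv_const_apply 1
    · have h1 : R⁻¹ • x ∈ tsupport f := support_fderiv_subset ℝ h0
      rw [f.tsupport_eq, mem_closedBall_zero_iff, hn, div_le_iff₀ hR] at h1
      exact h1

lemma mul_rpow_mul_pow_le_add {A B U y s k : ℝ} {n : ℕ} (hA : 0 ≤ A) (hB : 0 < B) (hU : 0 < U)
    (hy : 0 ≤ y) (hy1 : y ≤ 1) (hs : 0 < s) (hk : 0 < k) (hn : s / k ≤ n) :
    A * U ^ s * y ^ n ≤ B * U ^ (s + k) * y ^ (n + 1) + A * (A / B) ^ (s / k) := by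
  have hUs := rpow_pos_of_pos hU s
  have hUk := rpow_pos_of_pos hU k
  have hsk : 0 < s / k := div_pos hs hk
  rw [rpow_add hU]
  rcases le_or_gt A (B * (U ^ k * y)) with h | h
  · have h1 : A * (U ^ s * y ^ n) ≤ B * (U ^ k * y) * (U ^ s * y ^ n) := by gcongr
    have h2 : 0 ≤ A * (A / B) ^ (s / k) := by positivity
    calc _ = A * (U ^ s * y ^ n) := by ring
      _ ≤ B * (U ^ k * y) * (U ^ s * y ^ n) := h1
      _ = B * (U ^ s * U ^ k) * y ^ (n + 1) := by ring
      _ ≤ _ := by linarith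
  · have h1 : U ^ k * y ≤ A / B := by rw [le_div_iff₀ hB]; linarith
    have h2 : (U ^ k * y) ^ (s / k) ≤ (A / B) ^ (s / k) := by gcongr
    rw [mul_rpow hUk.le hy, ← rpow_mul hU.le, mul_div_cancel₀ _ hk.ne'] at h2
    have h3 : y ^ n ≤ y ^ (s / k) := by
      rw [← rpow_natCast y n]
      exact rpow_le_rpow_of_exponent_ge' hy hy1 hsk.le hn
    have h4 : 0 ≤ B * (U ^ s * U ^ k) * y ^ (n + 1) := by positivity
    calc _ = A * (U ^ s * y ^ n) := by ring
      _ ≤ A * (U ^ s * y ^ (s / k)) := by gcongr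
      _ ≤ A * (A / B) ^ (s / k) := by gcongr
      _ ≤ _ := by linarith

lemma one_add_sq_rpow_le {r R : ℝ} (e : ℝ) (hR : 1 ≤ R) (h1 : R ≤ r) (h2 : r ≤ 2 * R) :
    (1 + r ^ 2) ^ e ≤ 5 ^ |e| * R ^ (2 * e) := by
  have hR0 : 0 < R := by linarith
  have hs1 : 1 ≤ (1 + r ^ 2) / R ^ 2 := by
    rw [le_div_iff₀ (by positivity)]; nlinarith
  have hs5 : (1 + r ^ 2) / R ^ 2 ≤ 5 := by
    rw [div_le_iff₀ (by positivity)]; nlinarith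
  have h : 1 + r ^ 2 = (1 + r ^ 2) / R ^ 2 * R ^ 2 := by field_simp
  rw [h, mul_rpow (by positivity) (by positivity), rpow_mul hR0.le, rpow_two]
  gcongr
  calc ((1 + r ^ 2) / R ^ 2) ^ e ≤ ((1 + r ^ 2) / R ^ 2) ^ |e| :=
        rpow_le_rpow_of_exponent_le hs1 (le_abs_self e)
    _ ≤ 5 ^ |e| := by gcongr

lemma exists_cutoff_integral_le {p t : ℝ} (hp : 1 < p) (ht : 1 < t)
    {K : ℝ} (hK : 0 < K) {a b u : E → ℝ} (ha : Continuous a) (ha0 : ∀ x, 0 ≤ a x)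
    (hb : Continuous b) (hb0 : ∀ x, 0 < b x) (hu : Continuous u) (hu0 : ∀ x, 0 < u x)
    (hcac : ∀ φ : E → ℝ, ContDiff ℝ 2 φ → HasCompactSupport φ →
      ∫ x, b x * u x ^ (p - 1) * (u x ^ t * φ x) ^ 2 ≤
        K * ∫ x, a x * (u x ^ t) ^ 2 * ‖gradient φ x‖ ^ 2)
    {α β Ca Cb R₀ : ℝ} (hCa : 0 ≤ Ca) (hCb : 0 ≤ Cb)
    (haR : ∀ R ≥ R₀, ∀ x, R ≤ ‖x‖ → ‖x‖ ≤ 2 * R → a x ≤ Ca * R ^ α)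
    (hbR : ∀ R ≥ R₀, ∀ x, R ≤ ‖x‖ → ‖x‖ ≤ 2 * R → (b x)⁻¹ ≤ Cb * R ^ (-β)) :
    ∃ C : ℝ, ∀ R > 0, R₀ ≤ R → ∃ φ : E → ℝ, Continuous φ ∧ HasCompactSupport φ ∧
      (∀ x, ‖x‖ ≤ R → φ x = 1) ∧
      ∫ x, b x * u x ^ (p - 1) * (u x ^ t * φ x) ^ 2 ≤
        C * R ^ (N + α - 2 - 2 * t / (p - 1) * (β - α + 2)) := by
  obtain ⟨G, hG⟩ := exists_cutoff_family (N := N)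
  set q := 2 * t / (p - 1) with hq
  have hp1 : 0 < p - 1 := by linarith
  have hq0 : 0 < q := by positivity
  obtain ⟨n, hn⟩ := exists_nat_ge q
  set L : ℝ := (n + 1) ^ 2 * G ^ 2 with hL
  have hL0 : 0 ≤ L := by positivity
  set V : ℝ := volume.real (Metric.ball (0 : E) 1)
  refine ⟨2 * (K * (Ca * L * (2 * K * (Ca * L) * Cb) ^ q) * (2 ^ N * V)), fun R hR hR₀ => ?_⟩
  obtain ⟨χ, hχ, hχc, hχ0, hχ1, hχR, hχG, hχs⟩ := hG R hR
  have hφ : ContDiff ℝ 2 fun x => χ x ^ (n + 1) := hχ.pow _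
  have hφc : HasCompactSupport fun x => χ x ^ (n + 1) :=
    .intro hχc fun x hx => by simp [image_eq_zero_of_notMem_tsupport hx]
  refine ⟨fun x => χ x ^ (n + 1), hφ.continuous, hφc, fun x hx => by simp [hχR x hx], ?_⟩
  have hgφ (x : E) : gradient (fun x => χ x ^ (n + 1)) x =
      ((n + 1) * χ x ^ n) • gradient χ x := by
    have h := ((hχ.differentiable two_ne_zero x).hasFDerivAt.pow (n + 1)).fderiv
    simp only [gradient]
    rw [h, map_smul]
    simp
  have hcacφ := hcac _ hφ hφc
  set F : E → ℝ := fun x => b x * u x ^ (p - 1) * (u x ^ t * χ x ^ (n + 1)) ^ 2 with hF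
  set Z : E → ℝ := fun x => a x * (u x ^ t) ^ 2 * ‖gradient (fun x => χ x ^ (n + 1)) x‖ ^ 2
    with hZ
  set e := α - 2 + (α - β - 2) * q with he
  set M := Ca * L * (2 * K * (Ca * L) * Cb) ^ q * R ^ e with hM
  have hM0 : 0 ≤ M := by positivity
  have hpt (x : E) : K * Z x ≤ F x / 2 +
      (Metric.closedBall (0 : E) (2 * R)).indicator (fun _ => K * M) x := by
    have hF0 : 0 ≤ F x := by have := hb0 x; have := hu0 x; positivity
    by_cases hx : gradient χ x = 0
    · have h1 : Z x = 0 := by simp [hZ, hgφ, hx]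
      have h2 : 0 ≤ (Metric.closedBall (0 : E) (2 * R)).indicator (fun _ => K * M) x :=
        Set.indicator_nonneg (fun _ _ => by positivity) x
      rw [h1]; linarith
    · obtain ⟨hx1, hx2⟩ := hχs x hx
      rw [Set.indicator_of_mem (by simpa using hx2)]
      set A := a x * ((n + 1) ^ 2 * ‖gradient χ x‖ ^ 2) with hA
      have hA0 : 0 ≤ A := mul_nonneg (ha0 x) (by positivity)
      have hB0 : 0 < b x / (2 * K) := div_pos (hb0 x) (by positivity)
      have hmain := mul_rpow_mul_pow_le_add (s := 2 * t) (n := n) hA0 hB0 (hu0 x)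
        (sq_nonneg (χ x)) (pow_le_one₀ (hχ0 x) (hχ1 x)) (by positivity) hp1 hn
      have hut : u x ^ (2 * t) = (u x ^ t) ^ 2 := by
        rw [← rpow_mul_natCast (hu0 x).le]; push_cast; ring_nf
      have hZA : Z x = A * u x ^ (2 * t) * (χ x ^ 2) ^ n := by
        simp only [hZ, hgφ, hA, hut, norm_smul, mul_pow, Real.norm_eq_abs, sq_abs]
        ring
      have hFB : F x / (2 * K) = b x / (2 * K) * u x ^ (2 * t + (p - 1)) * (χ x ^ 2) ^ (n + 1) := by
        simp only [hF, rpow_add (hu0 x), hut]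
        ring
      have hA1 : A ≤ Ca * L * R ^ (α - 2) := by
        calc A ≤ (Ca * R ^ α) * ((n + 1) ^ 2 * (G / R) ^ 2) := by
              have := haR R hR₀ x hx1 hx2
              have := hχG x
              rw [hA]; gcongr
          _ = _ := by
              rw [rpow_sub hR, rpow_two, hL]; field_simp
      have hA2 : A / (b x / (2 * K)) ≤ 2 * K * (Ca * L) * Cb * R ^ (α - β - 2) := by
        calc A / (b x / (2 * K)) = 2 * K * A * (b x)⁻¹ := by field_simp
          _ ≤ 2 * K * (Ca * L * R ^ (α - 2)) * (Cb * R ^ (-β)) := by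
              have := hbR R hR₀ x hx1 hx2
              have := hb0 x
              gcongr
          _ = 2 * K * (Ca * L) * Cb * (R ^ (α - 2) * R ^ (-β)) := by ring
          _ = _ := by rw [← rpow_add hR]; ring_nf
      have hAM : A * (A / (b x / (2 * K))) ^ q ≤ M := by
        calc _ ≤ (Ca * L * R ^ (α - 2)) * (2 * K * (Ca * L) * Cb * R ^ (α - β - 2)) ^ q := by
              gcongr
          _ = Ca * L * (2 * K * (Ca * L) * Cb) ^ q * (R ^ (α - 2) * R ^ ((α - β - 2) * q)) := by
              rw [mul_rpow (by positivity) (by positivity), ← rpow_mul hR.le]; ring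
          _ = M := by rw [← rpow_add hR]
      rw [← hZA, ← hFB] at hmain
      calc K * Z x ≤ K * (F x / (2 * K) + M) := by gcongr; linarith
        _ = _ := by field_simp
  have hr (s : ℝ) : Continuous fun x => u x ^ s :=
    hu.rpow_const fun x => Or.inl (hu0 x).ne'
  have hχ' := hχ.continuous
  have hgφ' : Continuous (gradient fun x => χ x ^ (n + 1)) :=
    (contDiff_gradient (n := 1) hφ).continuous
  have iF : Integrable F := by
    refine Continuous.integrable_of_hasCompactSupport (by fun_prop) (.intro hχc fun x hx => ?_)
    simp [hF, image_eq_zero_of_notMem_tsupport hx]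
  have iZ : Integrable Z := by
    refine Continuous.integrable_of_hasCompactSupport (by fun_prop) (.intro
      (isCompact_closedBall (0 : E) (2 * R)) fun x hx => ?_)
    have : gradient χ x = 0 := by
      by_contra h
      exact hx (by simpa using (hχs x h).2)
    simp [hZ, hgφ, this]
  have iI : Integrable ((Metric.closedBall (0 : E) (2 * R)).indicator fun _ => K * M) :=
    (integrable_indicator_iff Metric.isClosed_closedBall.measurableSet).2
      (integrableOn_const (isCompact_closedBall _ _).measure_lt_top.ne)
  have hineq := integral_mono (iZ.const_mul K) ((iF.div_const 2).add iI) hpt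
  simp only [Pi.add_apply] at hineq
  rw [integral_const_mul, integral_add (iF.div_const 2) iI, integral_div,
    integral_indicator Metric.isClosed_closedBall.measurableSet, setIntegral_const,
    Measure.addHaar_real_closedBall _ _ (by positivity), smul_eq_mul] at hineq
  have hRe : R ^ (N + α - 2 - q * (β - α + 2)) = R ^ N * R ^ e := by
    rw [← rpow_natCast R N, ← rpow_add hR, he]; ring_nf
  rw [hRe]
  rw [finrank_euclideanSpace_fin] at hineq
  calc _ ≤ 2 * ((2 * R) ^ N * V * (K * M)) := by linarith
    _ = _ := by rw [hM, mul_pow]; ring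

end

theorem stmt_16 (N : ℕ) (hN : 1 ≤ N) (p : ℝ) (hp : 1 < p) (α β : ℝ)
    (h1 : 0 < (N : ℝ) + α - 2)
    (h2 : (N : ℝ) + α - 2 < 2*(β - α + 2)/(p - 1) * (p + Real.sqrt (p * (p - 1))))
    (g : EuclideanSpace ℝ (Fin N) → ℝ) (hg : ContDiff ℝ (⊤ : ℕ∞) g) (hgpos : ∀ x, 0 < g x)
    (c : ℝ) (hc : 0 < c) (hglim : Tendsto g (cocompact (EuclideanSpace ℝ (Fin N))) (nhds c)) :
    ¬ ∃ u : EuclideanSpace ℝ (Fin N) → ℝ, ContDiff ℝ 2 u ∧ (∀ x, 0 < u x) ∧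
      (∀ x, -vdiv (fun y => (fun x : EuclideanSpace ℝ (Fin N) => (1 + ‖x‖^2) ^ (α/2)) y • gradient u y) x ≤ (fun x : EuclideanSpace ℝ (Fin N) => g x * (1 + ‖x‖^2) ^ (β/2)) x * u x ^ p) ∧
      (∀ ψ : EuclideanSpace ℝ (Fin N) → ℝ, ContDiff ℝ 2 ψ → HasCompactSupport ψ →
        ∫ x, p * (fun x : EuclideanSpace ℝ (Fin N) => g x * (1 + ‖x‖^2) ^ (β/2)) x * u x ^ (p - 1) * ψ x ^ 2 ≤ ∫ x, (fun x : EuclideanSpace ℝ (Fin N) => (1 + ‖x‖^2) ^ (α/2)) x * ‖gradient ψ x‖ ^ 2) := by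

  rintro ⟨u, hu, hu0, hsub, hstab⟩
  simp only at hsub hstab
  obtain ⟨t, ht, hD, hγ⟩ := exists_exponent hp h1 h2
  have hw (e : ℝ) : ContDiff ℝ 1 fun x : EuclideanSpace ℝ (Fin N) => (1 + ‖x‖ ^ 2) ^ e :=
    (contDiff_const.add (contDiff_norm_sq ℝ)).rpow_const_of_ne fun x => by positivity
  have hb : Continuous fun x => g x * (1 + ‖x‖ ^ 2) ^ (β / 2) :=
    hg.continuous.mul (hw _).continuous
  have hb0 (x) : 0 < g x * (1 + ‖x‖ ^ 2) ^ (β / 2) := mul_pos (hgpos x) (by positivity)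
  obtain ⟨K, hK, hcac⟩ := exists_caccioppoli_const ht hD (hw (α / 2)) (fun x => by positivity) hb
    hu hu0 hsub hstab
  obtain ⟨R₁, hR₁⟩ : ∃ R₁ : ℝ, ∀ x, R₁ ≤ ‖x‖ → c / 2 ≤ g x := by
    have h := hglim.eventually (eventually_ge_nhds (half_lt_self hc))
    rw [← Metric.cobounded_eq_cocompact, ← comap_norm_atTop, eventually_comap, eventually_atTop] at h
    obtain ⟨R₁, h⟩ := h
    exact ⟨R₁, fun x hx => h ‖x‖ hx x rfl⟩
  obtain ⟨C, hC⟩ := exists_cutoff_integral_le (α := α) (β := β) (Ca := 5 ^ |α / 2|)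
    (Cb := (c / 2)⁻¹ * 5 ^ |-(β / 2)|) (R₀ := max 2 R₁) hp ht hK (hw (α / 2)).continuous
    (fun x => by positivity) hb hb0 hu.continuous hu0 hcac (by positivity) (by positivity)
    (fun R hR x h1 h2 => by
      have h := one_add_sq_rpow_le (α / 2) (one_le_two.trans ((le_max_left _ _).trans hR)) h1 h2
      rwa [mul_div_cancel₀ α two_ne_zero] at h)
    (fun R hR x h1 h2 => by
      have h := one_add_sq_rpow_le (-(β / 2)) (one_le_two.trans ((le_max_left _ _).trans hR)) h1 h2
      rw [mul_neg, mul_div_cancel₀ β two_ne_zero, rpow_neg (by positivity)] at h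
      have hgx := hR₁ x (((le_max_right _ _).trans hR).trans h1)
      rw [mul_inv, mul_assoc]
      gcongr)
  let f : ContDiffBump (0 : EuclideanSpace ℝ (Fin N)) := ⟨1, 2, one_pos, one_lt_two⟩
  have hr (s : ℝ) : Continuous fun x => u x ^ s :=
    hu.continuous.rpow_const fun x => Or.inl (hu0 x).ne'
  have hcont {φ : EuclideanSpace ℝ (Fin N) → ℝ} (hφ : Continuous φ) : Continuous fun x =>
      g x * (1 + ‖x‖ ^ 2) ^ (β / 2) * u x ^ (p - 1) * (u x ^ t * φ x) ^ 2 :=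
    (hb.mul (hr _)).mul (((hr _).mul hφ).pow 2)
  have hsupp {φ : EuclideanSpace ℝ (Fin N) → ℝ} (hφ : HasCompactSupport φ) :
      HasCompactSupport fun x =>
        g x * (1 + ‖x‖ ^ 2) ^ (β / 2) * u x ^ (p - 1) * (u x ^ t * φ x) ^ 2 :=
    .intro hφ fun x hx => by simp [image_eq_zero_of_notMem_tsupport hx]
  have hw0 (x) : 0 ≤ g x * (1 + ‖x‖ ^ 2) ^ (β / 2) * u x ^ (p - 1) :=
    (mul_pos (hb0 x) (rpow_pos_of_pos (hu0 x) _)).le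
  have hI := (hcont f.continuous).integral_pos_of_hasCompactSupport_nonneg_nonzero (μ := volume)
    (x := 0) (hsupp f.hasCompactSupport) (fun x => mul_nonneg (hw0 x) (sq_nonneg _)) (by
      have h1 := hb0 0
      have h2 := hu0 0
      have h3 : f 0 = 1 := f.one_of_mem_closedBall (by simp [f])
      rw [h3]
      positivity)
  have hlim : Tendsto (fun R : ℝ => C * R ^ (N + α - 2 - 2 * t / (p - 1) * (β - α + 2))) atTop
      (nhds 0) := by
    have h := (tendsto_rpow_neg_atTop (sub_pos.2 hγ)).const_mul C
    simpa using h
  obtain ⟨R, hR1, hR2⟩ := ((hlim.eventually (gt_mem_nhds hI)).and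
    (eventually_ge_atTop (max 2 R₁))).exists
  have h2R : 2 ≤ R := (le_max_left _ _).trans hR2
  obtain ⟨φ, hφ, hφc, hφ1, hφI⟩ := hC R (by linarith) hR2
  refine absurd (hφI.trans_lt hR1) (not_lt.2 ?_)
  refine integral_mono ((hcont f.continuous).integrable_of_hasCompactSupport
    (hsupp f.hasCompactSupport)) ((hcont hφ).integrable_of_hasCompactSupport (hsupp hφc))
    fun x => ?_
  refine mul_le_mul_of_nonneg_left ?_ (hw0 x)
  rcases le_or_gt ‖x‖ R with hx | hx
  · rw [hφ1 x hx]
    have h1 : 0 ≤ u x ^ t := (rpow_pos_of_pos (hu0 x) _).le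
    have h2 : 0 ≤ f x := f.nonneg
    gcongr
    exact f.le_one
  · have h1 : f x = 0 := f.zero_of_le_dist (by simpa [f] using h2R.trans hx.le)
    rw [h1]
    simp only [mul_zero, ne_eq, OfNat.ofNat_ne_zero, not_false_eq_true, zero_pow]
    positivity
end
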